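/- For every ε₀ ∈ (0,1) there exist constants c₀ > 0 and C > 0 (depending only on ε₀ and on γ) such that for every positive integer m which is a sum of two squares and satisfies |τ̂_m(4)| < 1 − ε₀, and for every subinterval I ⊆ [0,L] of length at most c₀/√m, the number of zeros Z_I = #{t ∈ I : F(γ(t)) = 0} satisfies Var(Z_I) ≤ C. -/

import Mathlib

open MeasureTheory ProbabilityTheory Real

noncomputable section

/-- The set of lattice points on the circle of radius `√m`:
`E = {μ ∈ ℤ² : μ₁² + μ₂² = m}` (all solutions satisfy `|μᵢ| ≤ m`). -/
def latticeSet (m : ℕ) : Finset (ℤ × ℤ) :=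
  (Finset.Icc (-(m : ℤ)) (m : ℤ) ×ˢ Finset.Icc (-(m : ℤ)) (m : ℤ)).filter
    (fun μ => μ.1 ^ 2 + μ.2 ^ 2 = (m : ℤ))

/-- `N = #E`, the number of lattice points on the circle of radius `√m`. -/
def latN (m : ℕ) : ℕ := (latticeSet m).card

/-- The probability space of the arithmetic random wave: `ℝ^E × ℝ^E`. -/
abbrev WaveSpace (m : ℕ) : Type :=
  (↥(latticeSet m) → ℝ) × (↥(latticeSet m) → ℝ)

/-- The Gaussian probability measure of the arithmetic random wave: the product of
standard Gaussian measures on `ℝ^E × ℝ^E`. -/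
def waveMeasure (m : ℕ) : Measure (WaveSpace m) :=
  (Measure.pi fun _ : ↥(latticeSet m) => gaussianReal 0 1).prod
    (Measure.pi fun _ : ↥(latticeSet m) => gaussianReal 0 1)

/-- The arithmetic random wave
`F(x) = N^{-1/2} ∑_{μ ∈ E} (b_μ cos(2π⟨μ,x⟩) + c_μ sin(2π⟨μ,x⟩))`. -/
def wave (m : ℕ) (ω : WaveSpace m) (x : ℝ × ℝ) : ℝ :=
  (Real.sqrt (latN m))⁻¹ *
    ∑ μ : ↥(latticeSet m),
      (ω.1 μ * Real.cos (2 * π * (((μ : ℤ × ℤ).1 : ℝ) * x.1 + ((μ : ℤ × ℤ).2 : ℝ) * x.2)) +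
       ω.2 μ * Real.sin (2 * π * (((μ : ℤ × ℤ).1 : ℝ) * x.1 + ((μ : ℤ × ℤ).2 : ℝ) * x.2)))

/-- The number of nodal intersections of the wave with the curve `γ` on `[0, L]`. -/
def nodalCount (m : ℕ) (γ : ℝ → ℝ × ℝ) (L : ℝ) (ω : WaveSpace m) : ℕ :=
  Set.ncard {t : ℝ | t ∈ Set.Icc 0 L ∧ wave m ω (γ t) = 0}

/-- The fourth Fourier coefficient of the angular measure:
`τ̂_m(4) = (N m²)⁻¹ ∑_{μ ∈ E} (μ₁⁴ − 6 μ₁² μ₂² + μ₂⁴)`. -/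
def tauHat4 (m : ℕ) : ℝ :=
  ((latN m : ℝ) * (m : ℝ) ^ 2)⁻¹ *
    ∑ μ ∈ latticeSet m,
      ((μ.1 : ℝ) ^ 4 - 6 * (μ.1 : ℝ) ^ 2 * (μ.2 : ℝ) ^ 2 + (μ.2 : ℝ) ^ 4)

/-- The law of a linear combination of independent standard Gaussian variables. -/
lemma map_sum_mul_pi_gaussianReal {ι : Type*} [Fintype ι] (u : ι → ℝ) :
    (Measure.pi fun _ : ι => gaussianReal 0 1).map (fun x => ∑ i, x i * u i) =
      gaussianReal 0 (∑ i, (u i ^ 2).toNNReal) := by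
  have hmap : (Measure.pi fun _ : ι => gaussianReal 0 1).map (fun x i => x i * u i) =
      Measure.pi fun i => gaussianReal 0 (u i ^ 2).toNNReal := by
    rw [Measure.pi_map_pi (f := fun i y => y * u i) (fun i => by fun_prop)]
    congr 1
    ext1 i
    rw [gaussianReal_map_mul_const]
    congr 1
    · simp
    · ext
      simp [sq_nonneg]
  have hcomp : (fun x : ι → ℝ => ∑ i, x i * u i) = (fun y => ∑ i, y i) ∘ fun x i => x i * u i :=
    rfl
  rw [hcomp, ← Measure.map_map (by fun_prop) (by fun_prop), hmap]
  refine Measure.ext_of_charFun ?_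
  rw [charFun_map_sum_pi_eq_prod]
  ext t
  simp only [Finset.prod_apply, charFun_gaussianReal, ← Complex.exp_sum]
  congr 1
  push_cast
  simp [Finset.sum_mul, Finset.sum_div, Finset.sum_neg_distrib]

lemma map_sum_add_sum_gaussianReal {ι : Type*} [Fintype ι] (u v : ι → ℝ) :
    ((Measure.pi fun _ : ι => gaussianReal 0 1).prod
      (Measure.pi fun _ : ι => gaussianReal 0 1)).map
        (fun x => ∑ i, (x.1 i * u i + x.2 i * v i)) =
      gaussianReal 0 (∑ i, (u i ^ 2 + v i ^ 2)).toNNReal := by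
  have hind := indepFun_prod (μ := Measure.pi fun _ : ι => gaussianReal 0 1)
    (ν := Measure.pi fun _ : ι => gaussianReal 0 1)
    (X := fun x : ι → ℝ => ∑ i, x i * u i) (Y := fun x : ι → ℝ => ∑ i, x i * v i)
    (by fun_prop) (by fun_prop)
  have hlaw := gaussianReal_add_gaussianReal_of_indepFun (m₁ := 0) (m₂ := 0)
    (v₁ := ∑ i, (u i ^ 2).toNNReal) (v₂ := ∑ i, (v i ^ 2).toNNReal) hind
    (by
      change Measure.map ((fun x : ι → ℝ => ∑ i, x i * u i) ∘ Prod.fst) _ = _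
      rw [← Measure.map_map (by fun_prop) measurable_fst, measurePreserving_fst.map_eq,
        map_sum_mul_pi_gaussianReal])
    (by
      change Measure.map ((fun x : ι → ℝ => ∑ i, x i * v i) ∘ Prod.snd) _ = _
      rw [← Measure.map_map (by fun_prop) measurable_snd, measurePreserving_snd.map_eq,
        map_sum_mul_pi_gaussianReal])
  convert hlaw using 2
  · ext x
    simp [Finset.sum_add_distrib]
  · simp
  · ext
    rw [Real.coe_toNNReal _ (Finset.sum_nonneg fun i _ => by positivity)]
    simp [Finset.sum_add_distrib, sq_nonneg]

lemma gaussianReal_abs_le_le (r : ℝ) :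
    gaussianReal 0 1 {x | |x| ≤ r} ≤ ENNReal.ofReal (2 * r) := by
  have hpdf : ∀ x, gaussianPDF 0 1 x ≤ 1 := by
    intro x
    rw [gaussianPDF, ENNReal.ofReal_le_one, gaussianPDFReal]
    have h1 : (1 : ℝ) ≤ √(2 * π * (1 : NNReal)) := by
      rw [Real.one_le_sqrt]
      have := Real.pi_gt_three
      norm_num
      linarith
    exact mul_le_one₀ (inv_le_one_of_one_le₀ h1) (Real.exp_nonneg _)
      (Real.exp_le_one_iff.2 (div_nonpos_of_nonpos_of_nonneg
        (neg_nonpos.2 (sq_nonneg _)) (by norm_num)))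
  rw [gaussianReal_apply _ one_ne_zero]
  calc ∫⁻ x in {x | |x| ≤ r}, gaussianPDF 0 1 x
      ≤ ∫⁻ _ in {x | |x| ≤ r}, 1 := lintegral_mono fun x => hpdf x
    _ = volume (Set.Icc (-r) r) := by
        rw [setLIntegral_one]
        congr 1
        ext x
        simp [abs_le]
    _ = ENNReal.ofReal (2 * r) := by
        rw [Real.volume_Icc]
        ring_nf

lemma lintegral_enorm_gaussianReal_le {s : ℝ} (hs : 0 < s) {v : NNReal} (hv : (v : ℝ) ≤ s ^ 2) :
    ∫⁻ x, ‖x‖ₑ ∂(gaussianReal 0 v) ≤ ENNReal.ofReal (2 * s) := by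
  have hint : Integrable (fun x : ℝ => x ^ 2) (gaussianReal 0 v) := by
    simpa using (memLp_id_gaussianReal' (μ := 0) (v := v) 2 (by simp)).integrable_sq
  have hsq : ∫ x, x ^ 2 ∂(gaussianReal 0 v) = v := by
    have h := variance_fun_id_gaussianReal (μ := 0) (v := v)
    rw [variance_eq_integral measurable_id'.aemeasurable] at h
    simpa using h
  have hle : ∀ x : ℝ, |x| ≤ s + x ^ 2 / s := by
    intro x
    rw [← sub_nonneg, show s + x ^ 2 / s - |x| = (s ^ 2 + |x| ^ 2 - |x| * s) / s by
      rw [sq_abs]; field_simp]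
    have := abs_nonneg x
    exact div_nonneg (by nlinarith [sq_nonneg (|x| - s)]) hs.le
  calc ∫⁻ x, ‖x‖ₑ ∂(gaussianReal 0 v)
      ≤ ∫⁻ x, ENNReal.ofReal (s + x ^ 2 / s) ∂(gaussianReal 0 v) := by
        refine lintegral_mono fun x => ?_
        rw [Real.enorm_eq_ofReal_abs]
        exact ENNReal.ofReal_le_ofReal (hle x)
    _ = ENNReal.ofReal (∫ x, (s + x ^ 2 / s) ∂(gaussianReal 0 v)) := by
        rw [ofReal_integral_eq_lintegral_ofReal]
        · exact (integrable_const _).add (hint.div_const _)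
        · exact Filter.Eventually.of_forall fun x => by positivity
    _ ≤ ENNReal.ofReal (2 * s) := by
        refine ENNReal.ofReal_le_ofReal ?_
        rw [integral_add (integrable_const _) (hint.div_const _), integral_div, hsq]
        have : (v : ℝ) / s ≤ s := by
          rw [div_le_iff₀ hs]
          nlinarith
        simp
        linarith

/-- A generalized Rolle theorem: a smooth function with `k + 1` zeros in an interval is bounded
there by `k` powers of the length of the interval times the `L¹` norm of its derivative of
order `k + 1`. -/
lemma enorm_le_pow_mul_lintegral_of_zeros {p q : ℝ} (k : ℕ) :
    ∀ {f : ℝ → ℝ}, ContDiff ℝ (⊤ : ℕ∞) f → ∀ z : ℕ → ℝ, (∀ i < k, z i < z (i + 1)) →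
      (∀ i ≤ k, z i ∈ Set.Icc p q ∧ f (z i) = 0) → ∀ x ∈ Set.Icc p q,
      ‖f x‖ₑ ≤ ENNReal.ofReal (q - p) ^ k *
        ∫⁻ t in Set.Icc p q, ‖iteratedDeriv (k + 1) f t‖ₑ := by
  induction k with
  | zero =>
    intro f hf z _ hz x hx
    obtain ⟨hz0, hfz⟩ := hz 0 le_rfl
    have hd : Continuous (deriv f) := hf.continuous_deriv (by simp)
    have hftc : ∫ t in (z 0)..x, deriv f t = f x := by
      rw [intervalIntegral.integral_deriv_eq_sub
        (fun t _ => (hf.differentiable (by simp)) t) (hd.intervalIntegrable _ _), hfz, sub_zero]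
    rw [← hftc, pow_zero, one_mul, zero_add, iteratedDeriv_one]
    rw [← ofReal_norm, intervalIntegral.norm_intervalIntegral_eq, ofReal_norm]
    refine (enorm_integral_le_lintegral_enorm _).trans (lintegral_mono_set ?_)
    exact Set.uIoc_subset_uIcc.trans (Set.uIcc_subset_Icc hz0 hx)
  | succ k ih =>
    intro f hf z hmono hz x hx
    have hdiff : Differentiable ℝ f := hf.differentiable (by simp)
    have hrolle : ∀ i, ∃ w, i ≤ k → w ∈ Set.Ioo (z i) (z (i + 1)) ∧ deriv f w = 0 := by
      intro i
      by_cases hi : i ≤ k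
      · obtain ⟨w, hw, hw0⟩ := exists_deriv_eq_zero (hmono i (by omega))
          hdiff.continuous.continuousOn ((hz i (by omega)).2.trans (hz (i + 1) (by omega)).2.symm)
        exact ⟨w, fun _ => ⟨hw, hw0⟩⟩
      · exact ⟨0, fun h => absurd h hi⟩
    choose w hw using hrolle
    have hderiv := ih (contDiff_infty_iff_deriv.1 hf).2 w
      (fun i hi => (hw i hi.le).1.2.trans (hw (i + 1) hi).1.1)
      (fun i hi => ⟨⟨(hz i (by omega)).1.1.trans (hw i hi).1.1.le,
        (hw i hi).1.2.le.trans (hz (i + 1) (by omega)).1.2⟩, (hw i hi).2⟩)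
    rw [← iteratedDeriv_succ'] at hderiv
    obtain ⟨hz0, hfz⟩ := hz 0 (by omega)
    set J := ∫⁻ t in Set.Icc p q, ‖iteratedDeriv (k + 1 + 1) f t‖ₑ
    by_cases hJ : J = ⊤
    · by_cases hpq : q - p ≤ 0
      · have hxz : x = z 0 := by linarith [hx.1, hx.2, hz0.1, hz0.2]
        simp [hxz, hfz]
      · rw [hJ, ENNReal.mul_top]
        · exact le_top
        · exact pow_ne_zero _ (by simpa using hpq)
    · have hfin : ENNReal.ofReal (q - p) ^ k * J ≠ ⊤ :=
        ENNReal.mul_ne_top (ENNReal.pow_ne_top ENNReal.ofReal_ne_top) hJ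
      have hmv := (convex_Icc p q).norm_image_sub_le_of_norm_deriv_le
        (C := (ENNReal.ofReal (q - p) ^ k * J).toReal) (fun t _ => hdiff t)
        (fun t ht => by
          rw [← toReal_enorm]
          exact ENNReal.toReal_mono hfin (hderiv t ht)) hz0 hx
      rw [hfz, sub_zero] at hmv
      rw [← ofReal_norm, pow_succ', mul_assoc, mul_comm (ENNReal.ofReal (q - p)),
        ← ENNReal.ofReal_toReal hfin, ← ENNReal.ofReal_mul ENNReal.toReal_nonneg]
      refine ENNReal.ofReal_le_ofReal (hmv.trans
        (mul_le_mul_of_nonneg_left ?_ ENNReal.toReal_nonneg))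
      rw [Real.norm_eq_abs, abs_le]
      constructor <;> linarith [hx.1, hx.2, hz0.1, hz0.2]

/-- If a smooth function has more than `k * n` zeros in an interval, then it is small at one of
the `n` left end points of the equal subintervals. -/
lemma exists_enorm_le_of_lt_ncard_zeros {f : ℝ → ℝ} (hf : ContDiff ℝ (⊤ : ℕ∞) f) {a b : ℝ}
    (hab : a ≤ b) {k n : ℕ} (hn : 0 < n)
    (hcard : k * n < Set.ncard {t | t ∈ Set.Icc a b ∧ f t = 0}) :
    ∃ i < n, ‖f (a + i * ((b - a) / n))‖ₑ ≤ ENNReal.ofReal ((b - a) / n) ^ k *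
      ∫⁻ t in Set.Icc a b, ‖iteratedDeriv (k + 1) f t‖ₑ := by
  have hn' : (0 : ℝ) < n := Nat.cast_pos.2 hn
  set δ := (b - a) / n with hδ
  have hδ0 : 0 ≤ δ := div_nonneg (sub_nonneg.2 hab) hn'.le
  have hnδ : n * δ = b - a := by rw [hδ]; field_simp
  have hcover : ∀ t, ∃ i, t ∈ Set.Icc a b → i < n ∧ t ∈ Set.Icc (a + i * δ) (a + i * δ + δ) := by
    intro t
    by_cases ht : t ∈ Set.Icc a b
    · by_contra! hcon
      have hall : ∀ i ≤ n, a + i * δ ≤ t ∧ (0 < i → a + i * δ < t) := by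
        intro i
        induction i with
        | zero => simpa using ht.1
        | succ i ih =>
          intro hi
          have h := (hcon i).2 (by omega)
          rw [Set.mem_Icc, not_and, not_le] at h
          have h' := h (ih (by omega)).1
          push_cast
          constructor
          · linarith
          · intro _
            linarith
      have h := (hall n le_rfl).2 hn
      linarith [ht.2]
    · exact ⟨0, fun h => absurd h ht⟩
  choose g hg using hcover
  have hfin : {t | t ∈ Set.Icc a b ∧ f t = 0}.Finite :=
    Set.finite_of_ncard_pos (by omega)
  rw [Set.ncard_eq_toFinset_card _ hfin] at hcard
  obtain ⟨i, hi, hlt⟩ := Finset.exists_lt_card_fiber_of_mul_lt_card_of_maps_to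
    (s := hfin.toFinset) (t := Finset.range n) (f := g) (n := k)
    (fun t ht => by
      rw [Set.Finite.mem_toFinset] at ht
      exact Finset.mem_range.2 (hg t ht.1).1)
    (by rwa [Finset.card_range, mul_comm])
  rw [Finset.mem_range] at hi
  refine ⟨i, hi, ?_⟩
  set S := hfin.toFinset.filter fun t => g t = i with hS
  have hSmem : ∀ t ∈ S, t ∈ Set.Icc (a + i * δ) (a + i * δ + δ) ∧ f t = 0 := by
    intro t ht
    rw [hS, Finset.mem_filter, Set.Finite.mem_toFinset] at ht
    obtain ⟨⟨ht1, ht2⟩, rfl⟩ := ht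
    exact ⟨(hg t ht1).2, ht2⟩
  let e := S.orderEmbOfCardLe (k := k + 1) hlt
  have hbound := enorm_le_pow_mul_lintegral_of_zeros (p := a + i * δ) (q := a + i * δ + δ) k hf
    (fun j => if h : j < k + 1 then e ⟨j, h⟩ else 0)
    (fun j hj => by
      rw [dif_pos (by omega), dif_pos (by omega)]
      exact e.strictMono (by simp))
    (fun j hj => by
      rw [dif_pos (by omega)]
      exact hSmem _ (S.orderEmbOfCardLe_mem _ _))
    (a + i * δ) ⟨le_rfl, by linarith⟩
  rw [add_sub_cancel_left] at hbound
  refine hbound.trans (mul_le_mul_right (lintegral_mono_set (Set.Icc_subset_Icc ?_ ?_)) _)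
  · have : 0 ≤ i * δ := by positivity
    linarith
  · have : ((i : ℝ) + 1) * δ ≤ n * δ :=
      mul_le_mul_of_nonneg_right (by exact_mod_cast hi) hδ0
    linarith

/-- A second moment bound for counting variables with cubically decaying tails. -/
lemma lintegral_natCast_sq_le {Ω : Type*} [MeasurableSpace Ω] (P : Measure Ω)
    [IsProbabilityMeasure P] (Z : Ω → ℕ) {k : ℕ} (hk : 0 < k) {p : ℕ → ENNReal}
    (hZ : ∀ n, P {ω | k * (n + 1) < Z ω} ≤ p n) :
    ∫⁻ ω, (Z ω : ENNReal) ^ 2 ∂P ≤ (k : ENNReal) ^ 2 * (1 + ∑' n : ℕ, (2 * n + 3) * p n) := by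
  set T : ℕ → Set Ω := fun n => toMeasurable P {ω | k * (n + 1) < Z ω} with hT
  have hTm : ∀ n, MeasurableSet (T n) := fun n => measurableSet_toMeasurable _ _
  have hpt : ∀ ω, (Z ω : ENNReal) ^ 2 ≤
      (k : ENNReal) ^ 2 * (1 + ∑' n : ℕ, (T n).indicator (fun _ => (2 * n + 3 : ENNReal)) ω) := by
    intro ω
    have hex : ∃ q, Z ω ≤ k * (q + 1) := ⟨Z ω, by nlinarith⟩
    classical
    set q := Nat.find hex
    have hq : Z ω ≤ k * (q + 1) := Nat.find_spec hex
    have hmem : ∀ n ∈ Finset.range q, ω ∈ T n := fun n hn =>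
      subset_toMeasurable _ _ (not_le.1 (Nat.find_min hex (Finset.mem_range.1 hn)))
    have hsum : (1 + ∑ n ∈ Finset.range q, (2 * n + 3 : ENNReal)) = ((q : ENNReal) + 1) ^ 2 := by
      have : ∀ q : ℕ, 1 + ∑ n ∈ Finset.range q, (2 * n + 3) = (q + 1) ^ 2 := by
        intro q
        induction q with
        | zero => simp
        | succ q ih => rw [Finset.sum_range_succ, ← add_assoc, ih]; ring
      exact_mod_cast this q
    calc (Z ω : ENNReal) ^ 2 ≤ (k * (q + 1) : ENNReal) ^ 2 := by
          gcongr
          exact_mod_cast hq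
      _ = (k : ENNReal) ^ 2 * (1 + ∑ n ∈ Finset.range q, (2 * n + 3 : ENNReal)) := by
          rw [hsum, mul_pow]
      _ = (k : ENNReal) ^ 2 * (1 + ∑ n ∈ Finset.range q,
            (T n).indicator (fun _ => (2 * n + 3 : ENNReal)) ω) := by
          congr 2
          exact Finset.sum_congr rfl fun n hn =>
            (Set.indicator_of_mem (hmem n hn) fun _ => (2 * n + 3 : ENNReal)).symm
      _ ≤ _ := by
          gcongr
          exact ENNReal.sum_le_tsum _
  calc ∫⁻ ω, (Z ω : ENNReal) ^ 2 ∂P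
      ≤ ∫⁻ ω, (k : ENNReal) ^ 2 *
          (1 + ∑' n : ℕ, (T n).indicator (fun _ => (2 * n + 3 : ENNReal)) ω) ∂P :=
        lintegral_mono hpt
    _ = (k : ENNReal) ^ 2 * (1 + ∑' n : ℕ, (2 * n + 3) * P (T n)) := by
        rw [lintegral_const_mul' _ _ (by simp), lintegral_add_left measurable_const,
          lintegral_tsum fun n => (measurable_const.indicator (hTm n)).aemeasurable]
        simp [hTm]
    _ ≤ _ := by
        gcongr with n
        rw [hT, measure_toMeasurable]
        exact hZ n

lemma tsum_mul_ofReal_div_cube_ne_top {c : ℝ} (hc : 0 ≤ c) :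
    ∑' n : ℕ, (2 * n + 3 : ENNReal) * ENNReal.ofReal (c / (n + 1 : ℝ) ^ 3) ≠ ⊤ := by
  have hsum : Summable fun n : ℕ => 3 * c / ((n + 1 : ℕ) : ℝ) ^ 2 := by
    simp_rw [div_eq_mul_inv]
    exact ((summable_nat_add_iff 1).2 (Real.summable_nat_pow_inv.2 one_lt_two)).mul_left _
  refine ne_top_of_le_ne_top hsum.tsum_ofReal_ne_top (ENNReal.tsum_le_tsum fun n => ?_)
  rw [show (2 * n + 3 : ENNReal) = ENNReal.ofReal (2 * n + 3) by
    rw [ENNReal.ofReal_add (by positivity) (by positivity), ENNReal.ofReal_mul (by positivity)]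
    simp, ← ENNReal.ofReal_mul (by positivity)]
  refine ENNReal.ofReal_le_ofReal ?_
  push_cast
  calc (2 * n + 3 : ℝ) * (c / (n + 1) ^ 3) ≤ (3 * (n + 1)) * (c / (n + 1) ^ 3) := by
        gcongr
        linarith [(Nat.cast_nonneg n : (0 : ℝ) ≤ n)]
    _ = 3 * c / (n + 1) ^ 2 := by field_simp

/-- A second moment bound gives a variance bound, without any measurability assumption. -/
lemma variance_le_of_lintegral_sq_le {Ω : Type*} [MeasurableSpace Ω] (P : Measure Ω)
    [IsProbabilityMeasure P] (X : Ω → ℝ) {B : ENNReal} (hB : B ≠ ⊤)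
    (hX : ∫⁻ ω, ‖X ω‖ₑ ^ 2 ∂P ≤ B) :
    variance X P ≤ (2 * (B + (1 + B) ^ 2)).toReal := by
  have hmean : ‖∫ ω, X ω ∂P‖ₑ ≤ 1 + B := by
    calc ‖∫ ω, X ω ∂P‖ₑ ≤ ∫⁻ ω, ‖X ω‖ₑ ∂P := enorm_integral_le_lintegral_enorm _
      _ ≤ ∫⁻ ω, (1 + ‖X ω‖ₑ ^ 2) ∂P := by
          refine lintegral_mono fun ω => ?_
          rcases le_total ‖X ω‖ₑ 1 with h | h
          · exact h.trans le_self_add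
          · exact (le_self_pow h two_ne_zero).trans le_add_self
      _ ≤ 1 + B := by
          rw [lintegral_add_left measurable_const]
          simpa using hX
  rw [variance]
  refine ENNReal.toReal_mono (by finiteness) ?_
  calc evariance X P ≤ ∫⁻ ω, 2 * (‖X ω‖ₑ ^ 2 + ‖∫ ω, X ω ∂P‖ₑ ^ 2) ∂P := by
        refine lintegral_mono fun ω => ?_
        rw [← enorm_pow, ← enorm_pow, ← enorm_pow, Real.enorm_of_nonneg (sq_nonneg _),
          Real.enorm_of_nonneg (sq_nonneg _), Real.enorm_of_nonneg (sq_nonneg _),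
          ← ENNReal.ofReal_add (sq_nonneg _) (sq_nonneg _),
          show (2 : ENNReal) = ENNReal.ofReal 2 by simp, ← ENNReal.ofReal_mul zero_le_two]
        exact ENNReal.ofReal_le_ofReal
          (by nlinarith [sq_nonneg (X ω + ∫ ω, X ω ∂P)])
    _ ≤ 2 * (B + (1 + B) ^ 2) := by
        rw [lintegral_const_mul' _ _ (by simp), lintegral_add_right _ measurable_const]
        simp only [lintegral_const, measure_univ, mul_one]
        gcongr

/-- The random sum `∑ i, (b_i U_i(t) + c_i V_i(t))`. -/
def randomSum {ι : Type*} [Fintype ι] (U V : ι → ℝ → ℝ) (ω : (ι → ℝ) × (ι → ℝ)) (t : ℝ) : ℝ :=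
  ∑ i, (ω.1 i * U i t + ω.2 i * V i t)

section RandomSum

variable {ι : Type*} [Fintype ι] {U V : ι → ℝ → ℝ}

lemma contDiff_randomSum (hU : ∀ i, ContDiff ℝ (⊤ : ℕ∞) (U i))
    (hV : ∀ i, ContDiff ℝ (⊤ : ℕ∞) (V i)) (ω : (ι → ℝ) × (ι → ℝ)) :
    ContDiff ℝ (⊤ : ℕ∞) (randomSum U V ω) := by
  unfold randomSum
  fun_prop

lemma iteratedDeriv_randomSum (hU : ∀ i, ContDiff ℝ (⊤ : ℕ∞) (U i))
    (hV : ∀ i, ContDiff ℝ (⊤ : ℕ∞) (V i)) (k : ℕ) (ω : (ι → ℝ) × (ι → ℝ)) (t : ℝ) :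
    iteratedDeriv k (randomSum U V ω) t =
      randomSum (fun i => iteratedDeriv k (U i)) (fun i => iteratedDeriv k (V i)) ω t := by
  have hU' : ∀ i, ContDiffAt ℝ k (U i) t := fun i => ((hU i).of_le (by exact_mod_cast le_top)).contDiffAt
  have hV' : ∀ i, ContDiffAt ℝ k (V i) t := fun i => ((hV i).of_le (by exact_mod_cast le_top)).contDiffAt
  unfold randomSum
  rw [iteratedDeriv_fun_sum fun i _ => by have := hU' i; have := hV' i; fun_prop]
  refine Finset.sum_congr rfl fun i _ => ?_
  have hadd := iteratedDeriv_add (n := k) (x := t) (f := fun t => ω.1 i * U i t)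
    (g := fun t => ω.2 i * V i t) (by have := hU' i; fun_prop) (by have := hV' i; fun_prop)
  rw [show (fun t => ω.1 i * U i t + ω.2 i * V i t) =
    (fun t => ω.1 i * U i t) + fun t => ω.2 i * V i t from rfl, hadd,
    iteratedDeriv_const_mul_field, iteratedDeriv_const_mul_field]

lemma measurable_randomSum_uncurry (hU : ∀ i, Continuous (U i)) (hV : ∀ i, Continuous (V i)) :
    Measurable fun x : ((ι → ℝ) × (ι → ℝ)) × ℝ => randomSum U V x.1 x.2 := by
  unfold randomSum
  have hU' := fun i => (hU i).measurable
  have hV' := fun i => (hV i).measurable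
  fun_prop

/-- A Gaussian random sum with unit variance has few zeros on an interval which is short at the
scale of its derivatives. -/
lemma measure_lt_ncard_zeros_randomSum_le (hU : ∀ i, ContDiff ℝ (⊤ : ℕ∞) (U i))
    (hV : ∀ i, ContDiff ℝ (⊤ : ℕ∞) (V i)) {a b s D : ℝ} (hab : a ≤ b) (hs : 0 < s)
    (hunit : ∀ t ∈ Set.Icc a b, ∑ i, (U i t ^ 2 + V i t ^ 2) = 1)
    (hder : ∀ t ∈ Set.Icc a b,
      ∑ i, (iteratedDeriv 8 (U i) t ^ 2 + iteratedDeriv 8 (V i) t ^ 2) ≤ s ^ 2)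
    (hD : (b - a) ^ 8 * s ≤ D) {n : ℕ} (hn : 0 < n) :
    ((Measure.pi fun _ : ι => gaussianReal 0 1).prod (Measure.pi fun _ : ι => gaussianReal 0 1))
      {ω | 7 * n < Set.ncard {t | t ∈ Set.Icc a b ∧ randomSum U V ω t = 0}} ≤
      ENNReal.ofReal ((2 * D + 2) / n ^ 3) := by
  set P := (Measure.pi fun _ : ι => gaussianReal 0 1).prod
    (Measure.pi fun _ : ι => gaussianReal 0 1)
  have hn' : (0 : ℝ) < n := Nat.cast_pos.2 hn
  have hba : 0 ≤ b - a := sub_nonneg.2 hab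
  set U' : ι → ℝ → ℝ := fun i => iteratedDeriv 8 (U i)
  set V' : ι → ℝ → ℝ := fun i => iteratedDeriv 8 (V i)
  have hcont : ∀ (k : ℕ) (f : ℝ → ℝ), ContDiff ℝ (⊤ : ℕ∞) f → Continuous (iteratedDeriv k f) :=
    fun k f hf => hf.continuous_iteratedDeriv k (mod_cast le_top)
  have hmeas : Measurable fun x : ((ι → ℝ) × (ι → ℝ)) × ℝ => ‖randomSum U' V' x.1 x.2‖ₑ :=
    (measurable_randomSum_uncurry (fun i => hcont 8 _ (hU i)) (fun i => hcont 8 _ (hV i))).enorm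
  set M : (ι → ℝ) × (ι → ℝ) → ENNReal := fun ω =>
    ENNReal.ofReal (b - a) ^ 7 * ∫⁻ t in Set.Icc a b, ‖randomSum U' V' ω t‖ₑ with hM
  have hMmeas : Measurable M := (hmeas.lintegral_prod_right').const_mul _
  have hlaw : ∀ t, ∫⁻ ω, ‖randomSum U' V' ω t‖ₑ ∂P =
      ∫⁻ x, ‖x‖ₑ ∂(gaussianReal 0 (∑ i, (U' i t ^ 2 + V' i t ^ 2)).toNNReal) := by
    intro t
    rw [← map_sum_add_sum_gaussianReal (fun i => U' i t) (fun i => V' i t),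
      lintegral_map measurable_enorm (by fun_prop)]
    rfl
  have hEM : ∫⁻ ω, M ω ∂P ≤ ENNReal.ofReal (2 * D) := by
    calc ∫⁻ ω, M ω ∂P
        = ENNReal.ofReal (b - a) ^ 7 *
            ∫⁻ t in Set.Icc a b, ∫⁻ ω, ‖randomSum U' V' ω t‖ₑ ∂P := by
          rw [lintegral_const_mul _ hmeas.lintegral_prod_right',
            lintegral_lintegral_swap hmeas.aemeasurable]
      _ ≤ ENNReal.ofReal (b - a) ^ 7 * ∫⁻ _ in Set.Icc a b, ENNReal.ofReal (2 * s) := by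
          refine mul_le_mul_right ?_ _
          refine setLIntegral_mono measurable_const fun t ht => ?_
          rw [hlaw]
          refine lintegral_enorm_gaussianReal_le hs ?_
          rw [Real.coe_toNNReal _ (Finset.sum_nonneg fun i _ => by positivity)]
          exact hder t ht
      _ = ENNReal.ofReal (2 * ((b - a) ^ 8 * s)) := by
          rw [setLIntegral_const, Real.volume_Icc, ← ENNReal.ofReal_pow hba,
            ← ENNReal.ofReal_mul (by positivity), ← ENNReal.ofReal_mul (by positivity)]
          ring_nf
      _ ≤ ENNReal.ofReal (2 * D) := ENNReal.ofReal_le_ofReal (by linarith)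
  have hlarge : P {ω | ENNReal.ofReal (n ^ 3) ≤ M ω} ≤ ENNReal.ofReal (2 * D / n ^ 3) := by
    rw [ENNReal.ofReal_div_of_pos (by positivity)]
    refine (meas_ge_le_lintegral_div hMmeas.aemeasurable (by simpa using hn.ne')
      ENNReal.ofReal_ne_top).trans ?_
    gcongr
  set x : ℕ → ℝ := fun i => a + i * ((b - a) / n)
  have hx : ∀ i < n, x i ∈ Set.Icc a b := by
    intro i hi
    have h0 : 0 ≤ i * ((b - a) / n) := by positivity
    have h1 : i * ((b - a) / n) ≤ n * ((b - a) / n) := by gcongr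
    rw [mul_div_cancel₀ _ hn'.ne'] at h1
    constructor <;> simp only [x] <;> linarith
  have hsmall : ∀ i < n, P {ω | |randomSum U V ω (x i)| ≤ 1 / n ^ 4} ≤
      ENNReal.ofReal (2 * (1 / n ^ 4)) := by
    intro i hi
    refine le_of_eq_of_le ?_ (gaussianReal_abs_le_le (1 / n ^ 4))
    rw [← Real.toNNReal_one, ← hunit (x i) (hx i hi),
      ← map_sum_add_sum_gaussianReal (fun j => U j (x i)) (fun j => V j (x i)),
      Measure.map_apply (by fun_prop) (measurableSet_le (by fun_prop) (by fun_prop))]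
    rfl
  have hsub : {ω | 7 * n < Set.ncard {t | t ∈ Set.Icc a b ∧ randomSum U V ω t = 0}} ⊆
      {ω | ENNReal.ofReal (n ^ 3) ≤ M ω} ∪
        ⋃ i ∈ Finset.range n, {ω | |randomSum U V ω (x i)| ≤ 1 / n ^ 4} := by
    intro ω hω
    by_cases hlt : ENNReal.ofReal (n ^ 3) ≤ M ω
    · exact Or.inl hlt
    right
    obtain ⟨i, hi, hle⟩ := exists_enorm_le_of_lt_ncard_zeros (contDiff_randomSum hU hV ω) hab hn hω
    simp only [Set.mem_iUnion, Finset.mem_range]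
    refine ⟨i, hi, ?_⟩
    have hMω : ENNReal.ofReal ((b - a) / n) ^ 7 *
        ∫⁻ t in Set.Icc a b, ‖iteratedDeriv (7 + 1) (randomSum U V ω) t‖ₑ =
        M ω / ENNReal.ofReal (n ^ 7) := by
      simp_rw [iteratedDeriv_randomSum hU hV]
      rw [ENNReal.ofReal_div_of_pos hn', ENNReal.ofReal_pow hn'.le, hM, div_eq_mul_inv,
        div_eq_mul_inv, mul_pow, ENNReal.inv_pow]
      ring
    rw [hMω] at hle
    have hle' : ‖randomSum U V ω (x i)‖ₑ ≤ ENNReal.ofReal (1 / n ^ 4) := by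
      calc ‖randomSum U V ω (x i)‖ₑ ≤ ENNReal.ofReal (n ^ 3) / ENNReal.ofReal (n ^ 7) :=
            hle.trans (by gcongr; exact (not_le.1 hlt).le)
        _ = ENNReal.ofReal (1 / n ^ 4) := by
            rw [← ENNReal.ofReal_div_of_pos (by positivity)]
            congr 1
            field_simp
    rw [Real.enorm_eq_ofReal_abs, ENNReal.ofReal_le_ofReal_iff (by positivity)] at hle'
    exact hle'
  have hD0 : 0 ≤ D := le_trans (by positivity) hD
  calc P {ω | 7 * n < Set.ncard {t | t ∈ Set.Icc a b ∧ randomSum U V ω t = 0}}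
      ≤ P {ω | ENNReal.ofReal (n ^ 3) ≤ M ω} +
          ∑ i ∈ Finset.range n, P {ω | |randomSum U V ω (x i)| ≤ 1 / n ^ 4} :=
        (measure_mono hsub).trans ((measure_union_le _ _).trans
          (add_le_add_right (measure_biUnion_finset_le _ _) _))
    _ ≤ ENNReal.ofReal (2 * D / n ^ 3) +
          ∑ i ∈ Finset.range n, ENNReal.ofReal (2 * (1 / n ^ 4)) :=
        add_le_add hlarge (Finset.sum_le_sum fun i hi => hsmall i (Finset.mem_range.1 hi))
    _ = ENNReal.ofReal ((2 * D + 2) / n ^ 3) := by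
        rw [Finset.sum_const, Finset.card_range, nsmul_eq_mul, ← ENNReal.ofReal_natCast n,
          ← ENNReal.ofReal_mul hn'.le, ← ENNReal.ofReal_add (by positivity) (by positivity)]
        congr 1
        field_simp

lemma variance_ncard_zeros_randomSum_le {D : ℝ} (hU : ∀ i, ContDiff ℝ (⊤ : ℕ∞) (U i))
    (hV : ∀ i, ContDiff ℝ (⊤ : ℕ∞) (V i)) {a b s : ℝ} (hab : a ≤ b) (hs : 0 < s)
    (hunit : ∀ t ∈ Set.Icc a b, ∑ i, (U i t ^ 2 + V i t ^ 2) = 1)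
    (hder : ∀ t ∈ Set.Icc a b,
      ∑ i, (iteratedDeriv 8 (U i) t ^ 2 + iteratedDeriv 8 (V i) t ^ 2) ≤ s ^ 2)
    (hD : (b - a) ^ 8 * s ≤ D) {B : ENNReal} (hB : B = (7 : ℕ) ^ 2 *
      (1 + ∑' n : ℕ, (2 * n + 3) * ENNReal.ofReal ((2 * D + 2) / (n + 1 : ℝ) ^ 3))) :
    variance
      (fun ω => ((Set.ncard {t | t ∈ Set.Icc a b ∧ randomSum U V ω t = 0} : ℕ) : ℝ))
      ((Measure.pi fun _ : ι => gaussianReal 0 1).prod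
        (Measure.pi fun _ : ι => gaussianReal 0 1)) ≤ (2 * (B + (1 + B) ^ 2)).toReal := by
  have hba : 0 ≤ b - a := sub_nonneg.2 hab
  have hD0 : 0 ≤ D := le_trans (by positivity) hD
  refine variance_le_of_lintegral_sq_le _ _ ?_ ?_
  · rw [hB]
    exact ENNReal.mul_ne_top (by simp) (ENNReal.add_ne_top.2
      ⟨by simp, tsum_mul_ofReal_div_cube_ne_top (by positivity)⟩)
  · rw [hB]
    simp_rw [Real.enorm_natCast]
    refine lintegral_natCast_sq_le _ _ (by norm_num) fun n => ?_
    have h := measure_lt_ncard_zeros_randomSum_le hU hV hab hs hunit hder hD n.succ_pos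
    push_cast at h
    exact h

end RandomSum

lemma abs_le_sqrt_of_mem_latticeSet {m : ℕ} {μ : ℤ × ℤ} (hμ : μ ∈ latticeSet m) :
    |(μ.1 : ℝ)| ≤ √m ∧ |(μ.2 : ℝ)| ≤ √m := by
  have h : (μ.1 : ℝ) ^ 2 + (μ.2 : ℝ) ^ 2 = m := by
    exact_mod_cast (Finset.mem_filter.1 hμ).2
  exact ⟨Real.abs_le_sqrt (by nlinarith [sq_nonneg (μ.2 : ℝ)]),
    Real.abs_le_sqrt (by nlinarith [sq_nonneg (μ.1 : ℝ)])⟩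

lemma latN_pos {m : ℕ} (h : ∃ a b : ℤ, a ^ 2 + b ^ 2 = (m : ℤ)) : 0 < latN m := by
  obtain ⟨a, b, hab⟩ := h
  refine Finset.card_pos.2 ⟨(a, b), ?_⟩
  simp only [latticeSet, Finset.mem_filter, Finset.mem_product, Finset.mem_Icc]
  refine ⟨⟨⟨?_, ?_⟩, ?_, ?_⟩, hab⟩ <;> nlinarith [sq_nonneg a, sq_nonneg b, sq_nonneg (a - 1),
    sq_nonneg (a + 1), sq_nonneg (b - 1), sq_nonneg (b + 1), Int.le_self_sq a, Int.le_self_sq b,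
    Int.le_self_sq (-a), Int.le_self_sq (-b)]

/-- The phase `2π⟨μ, γ(t)⟩`. -/
def phase (γ : ℝ → ℝ × ℝ) (μ : ℤ × ℤ) (t : ℝ) : ℝ :=
  2 * π * ((μ.1 : ℝ) * (γ t).1 + (μ.2 : ℝ) * (γ t).2)

lemma contDiff_phase {γ : ℝ → ℝ × ℝ} (hγ : ContDiff ℝ (⊤ : ℕ∞) γ) (μ : ℤ × ℤ) :
    ContDiff ℝ (⊤ : ℕ∞) (phase γ μ) := by
  unfold phase
  fun_prop

lemma norm_iteratedFDeriv_phase_le {γ : ℝ → ℝ × ℝ} (hγ : ContDiff ℝ (⊤ : ℕ∞) γ) {m : ℕ}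
    {μ : ℤ × ℤ} (hμ : μ ∈ latticeSet m) (k : ℕ) (t : ℝ) :
    ‖iteratedFDeriv ℝ k (phase γ μ) t‖ ≤ 4 * π * √m * ‖iteratedFDeriv ℝ k γ t‖ := by
  set T : ℝ × ℝ →L[ℝ] ℝ := (2 * π) • ((μ.1 : ℝ) • ContinuousLinearMap.fst ℝ ℝ ℝ +
    (μ.2 : ℝ) • ContinuousLinearMap.snd ℝ ℝ ℝ) with hT
  have hphase : phase γ μ = T ∘ γ := by
    ext t
    simp [phase, hT]
    ring
  have hnorm : ‖T‖ ≤ 4 * π * √m := by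
    refine T.opNorm_le_bound (by positivity) fun x => ?_
    obtain ⟨h1, h2⟩ := abs_le_sqrt_of_mem_latticeSet hμ
    calc ‖T x‖ = 2 * π * |(μ.1 : ℝ) * x.1 + (μ.2 : ℝ) * x.2| := by
          rw [← abs_of_pos Real.two_pi_pos, ← abs_mul, Real.norm_eq_abs]
          simp [hT, mul_add]
      _ ≤ 2 * π * (√m * ‖x‖ + √m * ‖x‖) := by
          gcongr
          refine (abs_add_le _ _).trans ?_
          rw [abs_mul, abs_mul]
          gcongr
          · exact norm_fst_le x
          · exact norm_snd_le x
      _ = 4 * π * √m * ‖x‖ := by ring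
  rw [hphase]
  refine (T.norm_iteratedFDeriv_comp_left hγ.contDiffAt (mod_cast le_top)).trans ?_
  gcongr

lemma exists_norm_iteratedFDeriv_le {γ : ℝ → ℝ × ℝ} (hγ : ContDiff ℝ (⊤ : ℕ∞) γ) (L : ℝ) (n : ℕ) :
    ∃ A : ℝ, ∀ k ≤ n, ∀ t ∈ Set.Icc 0 L, ‖iteratedFDeriv ℝ k γ t‖ ≤ A := by
  have h : ∀ k, ∃ A : ℝ, ∀ t ∈ Set.Icc 0 L, ‖iteratedFDeriv ℝ k γ t‖ ≤ A := fun k =>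
    isCompact_Icc.exists_bound_of_continuousOn
      (hγ.continuous_iteratedFDeriv (mod_cast le_top)).continuousOn
  choose A hA using h
  obtain ⟨B, hB⟩ := ((Finset.range (n + 1)).image A).bddAbove
  exact ⟨B, fun k hk t ht => (hA k t ht).trans
    (hB (Finset.mem_coe.2 (Finset.mem_image_of_mem A (Finset.mem_range.2 (by omega)))))⟩

/-- Derivatives of `g ∘ phase` along the curve grow at most like powers of `√m`. -/
lemma exists_iteratedDeriv_comp_phase_le {γ : ℝ → ℝ × ℝ} (hγ : ContDiff ℝ (⊤ : ℕ∞) γ) (L : ℝ)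
    (n : ℕ) :
    ∃ A : ℝ, 0 < A ∧ ∀ g : ℝ → ℝ, ContDiff ℝ (⊤ : ℕ∞) g → (∀ k x, |iteratedDeriv k g x| ≤ 1) →
      ∀ m : ℕ, 0 < m → ∀ μ ∈ latticeSet m, ∀ t ∈ Set.Icc 0 L,
        |iteratedDeriv n (fun t => g (phase γ μ t)) t| ≤ A * √m ^ n := by
  obtain ⟨B, hB⟩ := exists_norm_iteratedFDeriv_le hγ L n
  set A := max 1 (4 * π * B)
  have hA : 1 ≤ A := le_max_left _ _
  refine ⟨n.factorial * A ^ n, by positivity, fun g hg hg1 m hm μ hμ t ht => ?_⟩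
  have hm1 : 1 ≤ √m := Real.one_le_sqrt.2 (by exact_mod_cast hm)
  have hcomp := norm_iteratedFDeriv_comp_le hg (contDiff_phase hγ μ) (n := n) (mod_cast le_top) t
    (C := 1) (D := A * √m)
    (fun k _ => by
      rw [norm_iteratedFDeriv_eq_norm_iteratedDeriv]
      exact hg1 k _)
    (fun k hk1 hk => by
      calc ‖iteratedFDeriv ℝ k (phase γ μ) t‖ ≤ 4 * π * √m * B :=
            (norm_iteratedFDeriv_phase_le hγ hμ k t).trans (by gcongr; exact hB k hk t ht)
        _ = 4 * π * B * √m := by ring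
        _ ≤ A * √m := by
            gcongr
            exact le_max_right _ _
        _ ≤ (A * √m) ^ k := le_self_pow₀ (one_le_mul_of_one_le_of_one_le hA hm1) (by omega))
  rw [norm_iteratedFDeriv_eq_norm_iteratedDeriv, Real.norm_eq_abs] at hcomp
  refine hcomp.trans (le_of_eq ?_)
  ring

/-- Uniform bound on the nodal intersections variance on short arcs of length `≤ c₀/√m`. -/
theorem variance_short_arcs
    (L : ℝ) (hL : 0 < L) (γ : ℝ → ℝ × ℝ) (hγ : ContDiff ℝ (⊤ : ℕ∞) γ)
    (hunit : ∀ t ∈ Set.Icc (0:ℝ) L, (deriv γ t).1 ^ 2 + (deriv γ t).2 ^ 2 = 1)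
    (hcurv : ∀ t ∈ Set.Icc (0:ℝ) L, deriv (deriv γ) t ≠ 0) :
    ∀ ε₀ ∈ Set.Ioo (0:ℝ) 1, ∃ c₀ > 0, ∃ C > 0, ∀ m : ℕ, 0 < m →
      (∃ a b : ℤ, a ^ 2 + b ^ 2 = (m : ℤ)) →
      |tauHat4 m| < 1 - ε₀ →
      ∀ a b : ℝ, 0 ≤ a → a ≤ b → b ≤ L → b - a ≤ c₀ / Real.sqrt m →
        variance
          (fun ω => ((Set.ncard {t : ℝ | t ∈ Set.Icc a b ∧ wave m ω (γ t) = 0} : ℕ) : ℝ))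
          (waveMeasure m) ≤ C := by
  intro ε₀ _
  obtain ⟨A, hA, hbound⟩ := exists_iteratedDeriv_comp_phase_le hγ L 8
  set B : ENNReal := (7 : ℕ) ^ 2 * (1 + ∑' n : ℕ,
    (2 * n + 3) * ENNReal.ofReal ((2 * (2 * A) + 2) / (n + 1 : ℝ) ^ 3)) with hB
  refine ⟨1, one_pos, (2 * (B + (1 + B) ^ 2)).toReal + 1, by positivity, ?_⟩
  intro m hm hsum _ a b ha hab hb hshort
  have hN : (0 : ℝ) < latN m := Nat.cast_pos.2 (latN_pos hsum)
  have hm' : 0 < √(m : ℝ) := Real.sqrt_pos.2 (Nat.cast_pos.2 hm)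
  set r := (√(latN m : ℝ))⁻¹ with hr
  have hr2 : r ^ 2 * latN m = 1 := by
    rw [hr, inv_pow, Real.sq_sqrt hN.le, inv_mul_cancel₀ hN.ne']
  have hcard : Fintype.card ↥(latticeSet m) = latN m := by simp [latN]
  set U : ↥(latticeSet m) → ℝ → ℝ := fun μ t => r * cos (phase γ μ t) with hU
  set V : ↥(latticeSet m) → ℝ → ℝ := fun μ t => r * sin (phase γ μ t) with hV
  have hphase := fun μ : ↥(latticeSet m) => contDiff_phase hγ μ
  have hwave : ∀ ω t, wave m ω (γ t) = randomSum U V ω t := by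
    intro ω t
    rw [wave, randomSum, Finset.mul_sum]
    refine Finset.sum_congr rfl fun μ _ => ?_
    simp only [hU, hV, phase]
    ring
  have hder : ∀ g : ℝ → ℝ, ContDiff ℝ (⊤ : ℕ∞) g → (∀ k x, |iteratedDeriv k g x| ≤ 1) →
      ∀ μ : ↥(latticeSet m), ∀ t ∈ Set.Icc a b,
        iteratedDeriv 8 (fun t => r * g (phase γ μ t)) t ^ 2 ≤ r ^ 2 * (A * √m ^ 8) ^ 2 := by
    intro g hg hg1 μ t ht
    rw [iteratedDeriv_const_mul_field, mul_pow]
    gcongr ?_ * ?_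
    exact sq_le_sq.2 ((hbound g hg hg1 m hm μ μ.2 t ⟨ha.trans ht.1, ht.2.trans hb⟩).trans
      (le_abs_self _))
  have hvar := variance_ncard_zeros_randomSum_le (U := U) (V := V) (a := a) (b := b)
    (s := 2 * (A * √m ^ 8)) (D := 2 * A)
    (fun μ => by have := hphase μ; fun_prop) (fun μ => by have := hphase μ; fun_prop) hab
    (by positivity)
    (fun t _ => by
      calc ∑ μ, (U μ t ^ 2 + V μ t ^ 2) = ∑ _ : ↥(latticeSet m), r ^ 2 := by
            refine Finset.sum_congr rfl fun μ _ => ?_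
            simp only [hU, hV]
            linear_combination r ^ 2 * cos_sq_add_sin_sq (phase γ μ t)
        _ = 1 := by
            rw [Finset.sum_const, Finset.card_univ, hcard, nsmul_eq_mul, mul_comm, hr2])
    (fun t ht => by
      calc ∑ μ, (iteratedDeriv 8 (U μ) t ^ 2 + iteratedDeriv 8 (V μ) t ^ 2)
          ≤ ∑ _ : ↥(latticeSet m), (r ^ 2 * (A * √m ^ 8) ^ 2 + r ^ 2 * (A * √m ^ 8) ^ 2) :=
            Finset.sum_le_sum fun μ _ => add_le_add
              (hder cos contDiff_cos abs_iteratedDeriv_cos_le_one μ t ht)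
              (hder sin contDiff_sin abs_iteratedDeriv_sin_le_one μ t ht)
        _ = 2 * (A * √m ^ 8) ^ 2 := by
            rw [Finset.sum_const, Finset.card_univ, hcard, nsmul_eq_mul]
            linear_combination 2 * (A * √m ^ 8) ^ 2 * hr2
        _ ≤ (2 * (A * √m ^ 8)) ^ 2 := by nlinarith [sq_nonneg (A * √m ^ 8)])
    (by
      calc (b - a) ^ 8 * (2 * (A * √m ^ 8)) ≤ (1 / √m) ^ 8 * (2 * (A * √m ^ 8)) := by
            gcongr
        _ = 2 * A := by field_simp)
    hB
  simp_rw [hwave]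
  exact hvar.trans (by linarith)

end
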